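/- Let k be a positive integer. The set {K(a) : a ∈ ℤ, 0 ≤ a < k} is a complete system of representatives for the equivalence classes of virtual knots under 2k-moves and Ξ-moves: every virtual knot is related by a finite sequence of 2k-moves and Ξ-moves to exactly one K(a) with 0 ≤ a < k. In particular, the number of these equivalence classes is exactly k. -/

import Mathlib

/-!
Combinatorial Gauss diagrams.

A Gauss diagram is encoded as a list of chord endpoints read along the
oriented circle from a basepoint.  Each endpoint records the (natural number)
label of its chord, whether it is the terminal endpoint of the (oriented)
chord, and the sign of the chord (`true` = +1, `false` = -1).
Diagrams are considered up to rotation of the basepoint and relabeling of the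
chords; these renamings are included among the "Reidemeister" generators.
-/

structure Endpoint where
  label : ℕ
  isTerminal : Bool
  sign : Bool
deriving DecidableEq

namespace Gauss

/-- The sign (±1) of the chord through an endpoint. -/
def signValue (e : Endpoint) : ℤ := if e.sign then 1 else -1

/-- The sign assigned to an endpoint: `ε` at the terminal endpoint and `-ε`
at the initial endpoint of a chord of sign `ε`. -/
def endpointValue (e : Endpoint) : ℤ := if e.isTerminal then signValue e else -signValue e

/-- The list of chord labels of the endpoints of a word. -/
def labels (L : List Endpoint) : List ℕ := L.map Endpoint.label

/-- A word is a Gauss diagram when every chord label occurring in it occurs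
exactly twice, once as an initial and once as a terminal endpoint, with the
same sign at both occurrences. -/
def IsGaussDiagram (L : List Endpoint) : Prop :=
  ∀ e ∈ L, (L.filter (fun x => x.label == e.label)).length = 2 ∧
    ∃ e' ∈ L, e'.label = e.label ∧ e'.isTerminal = !e.isTerminal ∧ e'.sign = e.sign

/-- Rotate a word so that the first endpoint satisfying `p` comes first. -/
def rotateTo (L : List Endpoint) (p : Endpoint → Bool) : List Endpoint :=
  match L.findIdx? p with
  | some i => L.drop i ++ L.take i
  | none => L

/-- The index of the chord labeled `c`: the sum of the signs assigned to the
endpoints on the arc running from the initial endpoint of the chord to its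
terminal endpoint in the direction of the circle's orientation. -/
def chordIndex (L : List Endpoint) (c : ℕ) : ℤ :=
  ((((rotateTo L (fun e => e.label == c && !e.isTerminal)).drop 1).takeWhile
      (fun e => e.label != c)).map endpointValue).sum

/-- `Jn L n`: the sum of the signs of the chords of `L` of index `n`. -/
def Jn (L : List Endpoint) (n : ℤ) : ℤ :=
  ((L.filter (fun e => e.isTerminal && decide (chordIndex L e.label = n))).map signValue).sum

/-- The odd writhe: the sum of the signs of the chords of odd index,
i.e. `J = Σ_{n odd} J_n`. -/
def oddWrithe (L : List Endpoint) : ℤ :=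
  ((L.filter (fun e => e.isTerminal && decide (chordIndex L e.label % 2 ≠ 0))).map signValue).sum

/-- Moving the basepoint of the circle. -/
def rotateStep (L L' : List Endpoint) : Prop :=
  ∃ x xs, L = x :: xs ∧ L' = xs ++ [x]

/-- Injective relabeling of the chords. -/
def relabelStep (L L' : List Endpoint) : Prop :=
  ∃ f : ℕ → ℕ, Function.Injective f ∧
    L' = L.map (fun e => Endpoint.mk (f e.label) e.isTerminal e.sign)

/-- Reidemeister move I (removal direction): remove an isolated chord whose
two endpoints are adjacent (either orientation, either sign). -/
def reid1 (L L' : List Endpoint) : Prop :=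
  ∃ (A B : List Endpoint) (c : ℕ) (t s : Bool),
    c ∉ labels (A ++ B) ∧
    L = A ++ [Endpoint.mk c t s, Endpoint.mk c (!t) s] ++ B ∧
    L' = A ++ B

/-- Reidemeister move II (removal direction): remove two chords of opposite
signs whose initial endpoints are adjacent and whose terminal endpoints are
adjacent (in either of the two admissible orders). -/
def reid2 (L L' : List Endpoint) : Prop :=
  ∃ (A B C : List Endpoint) (c d : ℕ) (s crossed : Bool),
    c ≠ d ∧ c ∉ labels (A ++ B ++ C) ∧ d ∉ labels (A ++ B ++ C) ∧
    L = A ++ [Endpoint.mk c false s, Endpoint.mk d false (!s)] ++ B ++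
        (if crossed then [Endpoint.mk c true s, Endpoint.mk d true (!s)]
         else [Endpoint.mk d true (!s), Endpoint.mk c true s]) ++ C ∧
    L' = A ++ B ++ C

/-- Reidemeister move III (a standard variant; together with the moves I, II,
rotations and relabelings it generates all versions of the third move). -/
def reid3 (L L' : List Endpoint) : Prop :=
  ∃ (A B C D : List Endpoint) (a b c : ℕ) (s : Bool),
    a ≠ b ∧ b ≠ c ∧ a ≠ c ∧
    L = A ++ [Endpoint.mk b false s, Endpoint.mk a false s] ++ B ++
        [Endpoint.mk a true s, Endpoint.mk c false (!s)] ++ C ++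
        [Endpoint.mk b true s, Endpoint.mk c true (!s)] ++ D ∧
    L' = A ++ [Endpoint.mk a false s, Endpoint.mk b false s] ++ B ++
        [Endpoint.mk c false (!s), Endpoint.mk a true s] ++ C ++
        [Endpoint.mk c true (!s), Endpoint.mk b true s] ++ D

/-- A single Reidemeister generator (including diagram renamings). -/
def reidStep (L L' : List Endpoint) : Prop :=
  rotateStep L L' ∨ relabelStep L L' ∨ reid1 L L' ∨ reid2 L L' ∨ reid3 L L'

/-- A Ξ-move: exchange the first and third of three consecutive endpoints
belonging to three distinct chords, keeping all signs and orientations. -/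
def xiStep (L L' : List Endpoint) : Prop :=
  ∃ (A B : List Endpoint) (x y z : Endpoint),
    x.label ≠ y.label ∧ y.label ≠ z.label ∧ x.label ≠ z.label ∧
    L = A ++ [x, y, z] ++ B ∧
    L' = A ++ [z, y, x] ++ B

/-- A 2k-move (removal direction): remove `2k` chords `c 0, …, c (2k-1)`, all
of sign `s`, whose `p`-endpoints appear consecutively on one arc and whose
`q`-endpoints appear consecutively on a disjoint arc, the chord `c i` being
oriented from `p` to `q` for even `i` (the paper's odd `i`, 1-indexed) and
from `q` to `p` for odd `i`, so initial and terminal endpoints alternate. -/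
def move2k (k : ℕ) (L L' : List Endpoint) : Prop :=
  ∃ (A B C : List Endpoint) (c : ℕ → ℕ) (s : Bool),
    (∀ i < 2 * k, ∀ j < 2 * k, c i = c j → i = j) ∧
    (∀ i < 2 * k, c i ∉ labels (A ++ B ++ C)) ∧
    L = A ++ (List.range (2 * k)).map (fun i => Endpoint.mk (c i) (decide (i % 2 = 1)) s)
          ++ B ++
        (List.range (2 * k)).map (fun i => Endpoint.mk (c i) (decide (i % 2 = 0)) s)
          ++ C ∧
    L' = A ++ B ++ C

/-- A crossing change: reverse the sign and the orientation of one chord. -/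
def crossingChange (L L' : List Endpoint) : Prop :=
  ∃ c : ℕ,
    L' = L.map (fun e =>
      if e.label = c then Endpoint.mk e.label (!e.isTerminal) (!e.sign) else e)

/-- Finite sequences of moves from `r`, performed in either direction. -/
def Moves (r : List Endpoint → List Endpoint → Prop) :
    List Endpoint → List Endpoint → Prop :=
  Relation.ReflTransGen (fun L L' => r L L' ∨ r L' L)

/-- Related by Reidemeister moves: the two words represent the same virtual knot. -/
def ReidEquiv : List Endpoint → List Endpoint → Prop := Moves reidStep

/-- Related by a finite sequence of 2k-moves (and Reidemeister moves). -/
def Rel2k (k : ℕ) : List Endpoint → List Endpoint → Prop :=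
  Moves (fun L L' => reidStep L L' ∨ move2k k L L')

/-- Related by a finite sequence of Ξ-moves (and Reidemeister moves). -/
def RelXi : List Endpoint → List Endpoint → Prop :=
  Moves (fun L L' => reidStep L L' ∨ xiStep L L')

/-- Related by a finite sequence of 2k-moves and Ξ-moves (and Reidemeister moves). -/
def Rel2kXi (k : ℕ) : List Endpoint → List Endpoint → Prop :=
  Moves (fun L L' => reidStep L L' ∨ move2k k L L' ∨ xiStep L L')

/-- Related by a finite sequence of crossing changes and Ξ-moves
(and Reidemeister moves). -/
def RelCCXi : List Endpoint → List Endpoint → Prop :=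
  Moves (fun L L' => reidStep L L' ∨ crossingChange L L' ∨ xiStep L L')

/-- A shell-pair of sign `s`: two chords `c`, `d` of sign `s` whose four
endpoints are consecutive, interleaved as 1st-3rd and 2nd-4th
(with arbitrary orientations `t`, `u` of the two shells). -/
def shellPair (c d : ℕ) (t u s : Bool) : List Endpoint :=
  [Endpoint.mk c t s, Endpoint.mk d u s, Endpoint.mk c (!t) s, Endpoint.mk d (!u) s]

/-- The Gauss diagram `G(a)`: `|a|` consecutive shell-pairs of sign `+1` if
`a > 0` and of sign `-1` if `a < 0`; `G(0)` has no chords.  It represents the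
virtual knot `K(a)`. -/
def Gword (a : ℤ) : List Endpoint :=
  ((List.range a.natAbs).map
    (fun j => shellPair (2 * j) (2 * j + 1) false false (decide (0 < a)))).flatten

/-- `Rel2kCount k m G G'`: `G` and `G'` are related by a finite sequence of
Reidemeister moves and exactly `m` 2k-moves. -/
inductive Rel2kCount (k : ℕ) : ℕ → List Endpoint → List Endpoint → Prop
  | refl (L : List Endpoint) : Rel2kCount k 0 L L
  | reid {m : ℕ} {L L' L'' : List Endpoint} :
      reidStep L L' ∨ reidStep L' L →
      Rel2kCount k m L' L'' → Rel2kCount k m L L''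
  | move {m : ℕ} {L L' L'' : List Endpoint} :
      move2k k L L' ∨ move2k k L' L →
      Rel2kCount k m L' L'' → Rel2kCount k (m + 1) L L''

/-- The 2k-move distance: the minimal number of 2k-moves needed to relate the
two diagrams (together with Reidemeister moves). -/
noncomputable def dist2k (k : ℕ) (L L' : List Endpoint) : ℕ :=
  sInf {m | Rel2kCount k m L L'}

end Gauss

namespace Gauss

/-! ### Gauss diagrams: a local characterization -/

def filt (c : ℕ) (L : List Endpoint) : List Endpoint := L.filter (fun x => x.label == c)

def bar (h : Endpoint) : Endpoint := ⟨h.label, !h.isTerminal, h.sign⟩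

theorem bar_bar (h : Endpoint) : bar (bar h) = h := by simp [bar]

theorem bar_label (h : Endpoint) : (bar h).label = h.label := rfl

theorem filt_append (c : ℕ) (A B : List Endpoint) : filt c (A ++ B) = filt c A ++ filt c B := by
  simp [filt]

theorem filt_nil_of_notMem (c : ℕ) (A : List Endpoint) (h : c ∉ labels A) : filt c A = [] := by
  simp only [filt, List.filter_eq_nil_iff, beq_iff_eq]
  intro a ha e
  exact h (by simp only [labels, List.mem_map]; exact ⟨a, ha, e⟩)

theorem gauss_iff (L : List Endpoint) : IsGaussDiagram L ↔
    ∀ c, filt c L = [] ∨ ∃ h : Endpoint, h.label = c ∧ filt c L = [h, bar h] := by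
  constructor
  · intro H c
    by_cases hc : filt c L = []
    · exact Or.inl hc
    · right
      obtain ⟨e, he⟩ := List.exists_mem_of_ne_nil _ hc
      have he' := he
      simp only [filt, List.mem_filter, beq_iff_eq] at he'
      obtain ⟨heL, rfl⟩ := he'
      obtain ⟨h2, e', he'L, h3, h4, h5⟩ := H e heL
      have hm : e' ∈ filt e.label L := by simp [filt, he'L, h3]
      change (filt e.label L).length = 2 at h2
      have hb : e' = bar e := by
        cases e'; cases e; simp_all [bar]
      have hne : e' ≠ e := by
        rintro rfl; simp at h4
      obtain ⟨u, v, huv⟩ := List.length_eq_two.1 h2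
      rw [huv] at he hm ⊢
      simp only [List.mem_cons, List.not_mem_nil, or_false] at he hm
      rcases he with he | he <;> rcases hm with hm | hm
      · exact absurd (hm.trans he.symm) hne
      · exact ⟨e, rfl, by rw [← he, ← hm, hb]⟩
      · exact ⟨e', h3, by rw [← he, ← hm, hb, bar_bar]⟩
      · exact absurd (hm.trans he.symm) hne
  · intro H e he
    have hm : e ∈ filt e.label L := by simp [filt, he]
    rcases H e.label with h | ⟨h, hl, h2⟩
    · rw [h] at hm; simp at hm
    · refine ⟨by change (filt e.label L).length = 2; rw [h2]; rfl, bar e, ?_, rfl, rfl, rfl⟩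
      have : bar e ∈ filt e.label L := by
        rw [h2] at hm ⊢
        simp only [List.mem_cons, List.not_mem_nil, or_false] at hm ⊢
        rcases hm with hm | hm
        · right; rw [hm]
        · left; rw [hm, bar_bar]
      simp only [filt, List.mem_filter] at this
      exact this.1

theorem gauss_perm {L L' : List Endpoint} (h : L.Perm L') (H : IsGaussDiagram L) :
    IsGaussDiagram L' := by
  intro e he
  obtain ⟨h1, e', h2, h3⟩ := H e (h.mem_iff.2 he)
  exact ⟨by rw [← h1]; exact ((h.filter _).length_eq).symm, e', h.mem_iff.1 h2, h3⟩

theorem filt_eq_of_mem {c : ℕ} {P : List Endpoint} (h : filt c P = []) : c ∉ labels P := by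
  intro hm
  simp only [labels, List.mem_map] at hm
  obtain ⟨a, ha, rfl⟩ := hm
  have : a ∈ filt a.label P := by simp [filt, ha]
  rw [h] at this; simp at this

/-- Adding or removing a label-disjoint Gauss diagram. -/
theorem gauss_add {P L : List Endpoint} (hP : IsGaussDiagram P)
    (hd : ∀ c ∈ labels P, c ∉ labels L) : IsGaussDiagram (P ++ L) ↔ IsGaussDiagram L := by
  rw [gauss_iff] at hP
  rw [gauss_iff, gauss_iff]
  refine forall_congr' fun c => ?_
  rw [filt_append]
  by_cases h : c ∈ labels P
  · have h1 := filt_nil_of_notMem c L (hd c h)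
    rw [h1, List.append_nil]
    simp [hP c]
  · rw [filt_nil_of_notMem c P h, List.nil_append]

def D (e : List Endpoint) : List Endpoint := e.flatMap (fun h => [h, bar h])

theorem D_nil : D [] = [] := rfl
theorem D_cons (h : Endpoint) (e : List Endpoint) : D (h :: e) = h :: bar h :: D e := rfl

theorem mem_labels_D (e : List Endpoint) (c : ℕ) : c ∈ labels (D e) ↔ c ∈ labels e := by
  induction e with
  | nil => simp [D_nil]
  | cons h e ih =>
    rw [D_cons]
    simp only [labels, List.map_cons, List.mem_cons, bar_label] at ih ⊢
    rw [ih]; tauto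

theorem gauss_nil : IsGaussDiagram [] := by intro e he; simp at he

theorem gauss_pair (h : Endpoint) : IsGaussDiagram [h, bar h] := by
  rw [gauss_iff]
  intro c
  by_cases hc : h.label = c
  · right; exact ⟨h, hc, by simp [filt, bar, hc]⟩
  · left; simp [filt, bar, hc]

theorem gauss_D (e : List Endpoint) (hn : (labels e).Nodup) : IsGaussDiagram (D e) := by
  induction e with
  | nil => exact gauss_nil
  | cons h e ih =>
    simp only [labels, List.map_cons, List.nodup_cons] at hn
    have := (gauss_add (P := [h, bar h]) (L := D e) (gauss_pair h) (by
      intro c hc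
      simp only [labels, List.map_cons, List.map_nil, bar_label, List.mem_cons,
        List.not_mem_nil, or_false, or_self] at hc
      subst hc
      rw [mem_labels_D]; exact hn.1)).2 (ih hn.2)
    exact this

/-- Two endpoints with the same label in a Gauss diagram are partners. -/
theorem gauss_two {x y : Endpoint} {M : List Endpoint} (H : IsGaussDiagram (x :: y :: M))
    (hl : x.label = y.label) : y = bar x ∧ x.label ∉ labels M ∧ IsGaussDiagram M := by
  have H' := (gauss_iff _).1 H x.label
  have hf : filt x.label (x :: y :: M) = x :: y :: filt x.label M := by
    simp [filt, hl]
  rw [hf] at H'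
  rcases H' with h | ⟨h, h1, h2⟩
  · simp at h
  · simp only [List.cons.injEq] at h2
    obtain ⟨rfl, rfl, h3⟩ := h2
    have h4 := filt_eq_of_mem h3
    refine ⟨rfl, h4, ?_⟩
    refine (gauss_add (P := [x, bar x]) (gauss_pair x) ?_).1 H
    intro c hc
    simp only [labels, List.map_cons, List.map_nil, bar_label, List.mem_cons,
        List.not_mem_nil, or_false, or_self] at hc
    subst hc; exact h4

theorem gauss_partner {x : Endpoint} {M : List Endpoint} (H : IsGaussDiagram (x :: M)) :
    bar x ∈ M := by
  obtain ⟨-, e', h1, h2, h3, h4⟩ := H x (by simp)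
  have hb : e' = bar x := by cases e'; cases x; simp_all [bar]
  subst hb
  rcases List.mem_cons.1 h1 with h | h
  · rw [h] at h3; simp at h3
  · exact h

theorem gauss_even : ∀ (n : ℕ) (L : List Endpoint), L.length = n → IsGaussDiagram L →
    Even L.length := by
  intro n
  induction n using Nat.strong_induction_on with
  | _ n ih =>
    intro L hL H
    cases L with
    | nil => simp
    | cons x M =>
      obtain ⟨A, C, rfl⟩ := List.append_of_mem (gauss_partner H)
      have hp : (x :: (A ++ bar x :: C)).Perm (x :: bar x :: (A ++ C)) :=
        List.Perm.cons _ List.perm_middle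
      have := gauss_two (gauss_perm hp H) rfl
      have h2 := ih (A ++ C).length (by simp at hL ⊢; omega) _ rfl this.2.2
      simp only [List.length_cons, List.length_append] at h2 ⊢
      grind

/-! ### The invariant -/

def alt (c : ℕ) : List Endpoint → ℤ
  | [] => 0
  | x :: xs => (if x.label = c then 1 else 0) - alt c xs

theorem alt_append (c : ℕ) (A B : List Endpoint) :
    alt c (A ++ B) = alt c A + (-1) ^ A.length * alt c B := by
  induction A with
  | nil => simp [alt]
  | cons x A ih => simp only [List.cons_append, alt, ih, List.length_cons, pow_succ]; ring

theorem alt_notMem (c : ℕ) (A : List Endpoint) (h : c ∉ labels A) : alt c A = 0 := by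
  induction A with
  | nil => rfl
  | cons x A ih =>
    simp only [labels, List.map_cons, List.mem_cons, not_or] at h
    rw [alt, ih h.2, if_neg (Ne.symm h.1)]; rfl

/-- Sum over a word of the signs weighted by the function `w` of labels. -/
def wsum (w : ℕ → ℤ) (L : List Endpoint) : ℤ := (L.map (fun e => signValue e * w e.label)).sum

theorem wsum_append (w : ℕ → ℤ) (A B : List Endpoint) :
    wsum w (A ++ B) = wsum w A + wsum w B := by simp [wsum]

theorem wsum_cons (w : ℕ → ℤ) (x : Endpoint) (B : List Endpoint) :
    wsum w (x :: B) = signValue x * w x.label + wsum w B := by simp [wsum]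

theorem wsum_nil (w : ℕ → ℤ) : wsum w [] = 0 := rfl

theorem wsum_perm (w : ℕ → ℤ) {A B : List Endpoint} (h : A.Perm B) : wsum w A = wsum w B :=
  (h.map _).sum_eq

theorem wsum_congr {w w' : ℕ → ℤ} {L : List Endpoint} (h : ∀ c ∈ labels L, w c = w' c) :
    wsum w L = wsum w' L := by
  unfold wsum
  congr 1
  apply List.map_congr_left
  intro a ha
  rw [h a.label (List.mem_map_of_mem ha)]

def inv (L : List Endpoint) : ℤ := wsum (fun c => alt c L ^ 2) L

theorem inv_perm {L L' : List Endpoint} (h : L.Perm L')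
    (hw : ∀ c, alt c L ^ 2 = alt c L' ^ 2) : inv L = inv L' := by
  unfold inv
  rw [wsum_perm _ h]
  exact wsum_congr fun c _ => hw c

theorem inv_rotate {L L' : List Endpoint} (h : rotateStep L L') (H : IsGaussDiagram L) :
    inv L = inv L' := by
  obtain ⟨x, xs, rfl, rfl⟩ := h
  have he := gauss_even _ _ rfl H
  apply inv_perm
  · exact (List.perm_append_singleton x xs).symm
  · intro c
    have hodd : Odd xs.length := by
      simp only [List.length_cons] at he; grind
    rw [alt_append, hodd.neg_one_pow]
    simp only [alt]; ring

theorem inv_relabel {L L' : List Endpoint} (h : relabelStep L L') : inv L = inv L' := by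
  obtain ⟨f, hf, rfl⟩ := h
  have key : ∀ c (M : List Endpoint),
      alt (f c) (M.map (fun e => Endpoint.mk (f e.label) e.isTerminal e.sign)) = alt c M := by
    intro c M
    induction M with
    | nil => rfl
    | cons x M ih => simp only [List.map_cons, alt, ih, hf.eq_iff]
  unfold inv wsum
  rw [List.map_map]
  congr 1
  apply List.map_congr_left
  intro a _
  simp only [Function.comp, key, signValue]

theorem labels_append (A B : List Endpoint) : labels (A ++ B) = labels A ++ labels B := by
  simp [labels]

/-- General removal computation. -/
theorem inv_remove {L P L' : List Endpoint} (hp : L.Perm (P ++ L'))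
    (hL' : ∀ c ∈ labels L', alt c L = alt c L') :
    inv L = wsum (fun c => alt c L ^ 2) P + inv L' := by
  unfold inv
  rw [wsum_perm _ hp, wsum_append]
  congr 1
  apply wsum_congr
  intro c hc
  simp only [hL' c hc]

theorem inv_reid1 {L L' : List Endpoint} (h : reid1 L L') : inv L = inv L' := by
  obtain ⟨A, B, c, t, s, hc, rfl, rfl⟩ := h
  have ha : ∀ d, alt d (A ++ [Endpoint.mk c t s, Endpoint.mk c (!t) s] ++ B) = alt d (A ++ B) := by
    intro d
    simp only [alt_append, alt, List.length_append, List.length_cons, List.length_nil, pow_add]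
    ring
  rw [inv_remove (P := [Endpoint.mk c t s, Endpoint.mk c (!t) s]) (L' := A ++ B) _
    (fun d _ => ha d)]
  · simp only [wsum_cons, wsum_nil, ha, alt_notMem c _ hc]; ring
  · rw [List.append_assoc]
    refine (List.perm_append_comm_assoc _ _ _).trans ?_
    simp

theorem inv_reid2 {L L' : List Endpoint} (h : reid2 L L') : inv L = inv L' := by
  obtain ⟨A, B, C, c, d, s, cr, hcd, hc, hd, rfl, rfl⟩ := h
  have h1 := hc
  have h2 := hd
  simp only [labels_append, List.mem_append, not_or] at h1 h2
  rw [inv_remove (P := [Endpoint.mk c false s, Endpoint.mk d false (!s)] ++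
     (if cr then [Endpoint.mk c true s, Endpoint.mk d true (!s)]
         else [Endpoint.mk d true (!s), Endpoint.mk c true s])) (L' := A ++ B ++ C)]
  · have hdc := Ne.symm hcd
    cases cr <;> cases s <;>
    · simp [wsum_cons, wsum_nil, signValue, alt_append, alt, hcd, hdc,
        alt_notMem _ _ h1.1.1, alt_notMem _ _ h1.1.2,
        alt_notMem _ _ h1.2, alt_notMem _ _ h2.1.1, alt_notMem _ _ h2.1.2,
        alt_notMem _ _ h2.2]
      ring
  · rw [← Multiset.coe_eq_coe]
    simp only [← Multiset.coe_add]
    abel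
  · intro x hx
    have hxc : c ≠ x := fun h => hc (h ▸ hx)
    have hxd : d ≠ x := fun h => hd (h ▸ hx)
    cases cr <;>
    · simp [alt_append, alt, hxc, hxd]

theorem inv_reid3 {L L' : List Endpoint} (h : reid3 L L') (H : IsGaussDiagram L) :
    inv L = inv L' := by
  obtain ⟨A, B, C, D, a, b, c, s, hab, hbc, hac, rfl, rfl⟩ := h
  have hp : (A ++ [Endpoint.mk b false s, Endpoint.mk a false s] ++ B ++
        [Endpoint.mk a true s, Endpoint.mk c false (!s)] ++ C ++
        [Endpoint.mk b true s, Endpoint.mk c true (!s)] ++ D).Perm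
      (Endpoint.mk a false s :: Endpoint.mk a true s ::
        Endpoint.mk b false s :: Endpoint.mk b true s ::
        Endpoint.mk c false (!s) :: Endpoint.mk c true (!s) :: (A ++ B ++ C ++ D)) := by
    rw [← Multiset.coe_eq_coe]
    simp only [← Multiset.coe_add, ← Multiset.cons_coe, ← Multiset.singleton_add, Multiset.coe_nil]
    abel
  have G0 := gauss_perm hp H
  have G1 := gauss_two G0 rfl
  have G2 := gauss_two G1.2.2 rfl
  have G3 := gauss_two G2.2.2 rfl
  have g1 := G1.2.1
  have g2 := G2.2.1
  have g3 := G3.2.1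
  simp only [List.mem_append, not_or, labels, List.map_cons,
    List.mem_cons, List.map_append] at g1 g2 g3
  apply inv_perm
  · rw [← Multiset.coe_eq_coe]
    simp only [← Multiset.coe_add, ← Multiset.cons_coe, ← Multiset.singleton_add, Multiset.coe_nil]
    abel
  · intro x
    have hba := Ne.symm hab
    have hca := Ne.symm hac
    have hcb := Ne.symm hbc
    by_cases hxa : a = x
    · subst hxa
      have z : ∀ M, a ∉ List.map Endpoint.label M → alt a M = 0 := fun M h => alt_notMem a M h
      simp [alt_append, alt, z, g1, hba, hca]
      try ring
    by_cases hxb : b = x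
    · subst hxb
      have z : ∀ M, b ∉ List.map Endpoint.label M → alt b M = 0 := fun M h => alt_notMem b M h
      simp [alt_append, alt, z, g2, hab, hcb]
      try ring
    by_cases hxc : c = x
    · subst hxc
      have z : ∀ M, c ∉ List.map Endpoint.label M → alt c M = 0 := fun M h => alt_notMem c M h
      simp [alt_append, alt, z, g3, hac, hbc]
      try ring
    · simp [alt_append, alt, hxa, hxb, hxc]

theorem inv_xi {L L' : List Endpoint} (h : xiStep L L') : inv L = inv L' := by
  obtain ⟨A, B, x, y, z, -, -, -, rfl, rfl⟩ := h
  apply inv_perm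
  · rw [← Multiset.coe_eq_coe]
    simp only [← Multiset.coe_add, ← Multiset.cons_coe, ← Multiset.singleton_add, Multiset.coe_nil]
    abel
  · intro c
    congr 1
    simp only [alt_append, alt, List.length_append, List.length_cons]
    ring

end Gauss
namespace Gauss

/-! ### The moves preserve Gauss diagrams -/

theorem gauss_add_perm {L P L' : List Endpoint} (hp : L.Perm (P ++ L')) (hP : IsGaussDiagram P)
    (hd : ∀ c ∈ labels P, c ∉ labels L') : IsGaussDiagram L ↔ IsGaussDiagram L' := by
  rw [← gauss_add hP hd]
  exact ⟨gauss_perm hp, gauss_perm hp.symm⟩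

theorem gauss_perm_iff {L L' : List Endpoint} (hp : L.Perm L') :
    IsGaussDiagram L ↔ IsGaussDiagram L' := ⟨gauss_perm hp, gauss_perm hp.symm⟩

theorem gauss_relabel {L L' : List Endpoint} (h : relabelStep L L') :
    IsGaussDiagram L ↔ IsGaussDiagram L' := by
  obtain ⟨f, hf, rfl⟩ := h
  have hlen : ∀ c, ((L.map (fun e => Endpoint.mk (f e.label) e.isTerminal e.sign)).filter
      (fun x => x.label == f c)).length = (L.filter (fun x => x.label == c)).length := by
    intro c
    rw [List.filter_map, List.length_map]
    congr 2
    funext x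
    simp [hf.eq_iff, Bool.beq_eq_decide_eq]
  constructor
  · intro H e he
    obtain ⟨a, ha, rfl⟩ := List.mem_map.1 he
    obtain ⟨h1, e', h2, h3, h4, h5⟩ := H a ha
    refine ⟨by rw [hlen, h1], _, List.mem_map.2 ⟨e', h2, rfl⟩, ?_, h4, h5⟩
    simp [h3]
  · intro H a ha
    obtain ⟨h1, e', h2, h3, h4, h5⟩ := H _ (List.mem_map.2 ⟨a, ha, rfl⟩)
    obtain ⟨b, hb, rfl⟩ := List.mem_map.1 h2
    exact ⟨by rw [← hlen, h1], b, hb, hf h3, h4, h5⟩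

theorem gauss_reid1 {L L' : List Endpoint} (h : reid1 L L') :
    IsGaussDiagram L ↔ IsGaussDiagram L' := by
  obtain ⟨A, B, c, t, s, hc, rfl, rfl⟩ := h
  refine gauss_add_perm (P := [Endpoint.mk c t s, Endpoint.mk c (!t) s]) ?_
    (gauss_pair (Endpoint.mk c t s)) ?_
  · rw [List.append_assoc]
    refine (List.perm_append_comm_assoc _ _ _)
  · intro d hd
    simp only [labels, List.map_cons, List.map_nil, List.mem_cons,
        List.not_mem_nil, or_false, or_self] at hd
    subst hd; exact hc

theorem gauss_reid2 {L L' : List Endpoint} (h : reid2 L L') :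
    IsGaussDiagram L ↔ IsGaussDiagram L' := by
  obtain ⟨A, B, C, c, d, s, cr, hcd, hc, hd, rfl, rfl⟩ := h
  refine gauss_add_perm (P := D [Endpoint.mk c false s, Endpoint.mk d false (!s)]) ?_
    (gauss_D _ (by simpa [labels] using hcd)) ?_
  · rw [← Multiset.coe_eq_coe]
    cases cr <;>
    · simp only [D_cons, D_nil, ← Multiset.coe_add, ← Multiset.cons_coe,
        ← Multiset.singleton_add, Multiset.coe_nil, bar, Bool.not_false, if_true,
        Bool.false_eq_true, if_false]
      abel
  · intro x hx
    rw [mem_labels_D] at hx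
    simp only [labels, List.map_cons, List.map_nil, List.mem_cons,
        List.not_mem_nil, or_false] at hx
    rcases hx with rfl | rfl
    · exact hc
    · exact hd

theorem reid3_perm {L L' : List Endpoint} (h : reid3 L L') : L.Perm L' := by
  obtain ⟨A, B, C, D, a, b, c, s, hab, hbc, hac, rfl, rfl⟩ := h
  rw [← Multiset.coe_eq_coe]
  simp only [← Multiset.coe_add, ← Multiset.cons_coe, ← Multiset.singleton_add, Multiset.coe_nil]
  abel

theorem xi_perm {L L' : List Endpoint} (h : xiStep L L') : L.Perm L' := by
  obtain ⟨A, B, x, y, z, -, -, -, rfl, rfl⟩ := h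
  rw [← Multiset.coe_eq_coe]
  simp only [← Multiset.coe_add, ← Multiset.cons_coe, ← Multiset.singleton_add, Multiset.coe_nil]
  abel

theorem gauss_reidStep {L L' : List Endpoint} (h : reidStep L L') :
    IsGaussDiagram L ↔ IsGaussDiagram L' := by
  rcases h with h | h | h | h | h
  · obtain ⟨x, xs, rfl, rfl⟩ := h
    exact gauss_perm_iff (List.perm_append_singleton x xs).symm
  · exact gauss_relabel h
  · exact gauss_reid1 h
  · exact gauss_reid2 h
  · exact gauss_perm_iff (reid3_perm h)

theorem inv_reidStep {L L' : List Endpoint} (h : reidStep L L') (H : IsGaussDiagram L) :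
    inv L = inv L' := by
  rcases h with h | h | h | h | h
  · exact inv_rotate h H
  · exact inv_relabel h
  · exact inv_reid1 h
  · exact inv_reid2 h
  · exact inv_reid3 h H

/-! ### The `2k`-move -/

def pBlock (c : ℕ → ℕ) (n : ℕ) (s : Bool) : List Endpoint :=
  (List.range n).map (fun i => Endpoint.mk (c i) (decide (i % 2 = 1)) s)

def qBlock (c : ℕ → ℕ) (n : ℕ) (s : Bool) : List Endpoint :=
  (List.range n).map (fun i => Endpoint.mk (c i) (decide (i % 2 = 0)) s)

theorem labels_pBlock (c : ℕ → ℕ) (n : ℕ) (s : Bool) :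
    labels (pBlock c n s) = (List.range n).map c := by
  simp [labels, pBlock, Function.comp_def]

theorem labels_qBlock (c : ℕ → ℕ) (n : ℕ) (s : Bool) :
    labels (qBlock c n s) = (List.range n).map c := by
  simp [labels, qBlock, Function.comp_def]

theorem D_pBlock_perm (c : ℕ → ℕ) (n : ℕ) (s : Bool) :
    (pBlock c n s ++ qBlock c n s).Perm (D (pBlock c n s)) := by
  induction n with
  | zero => simp [pBlock, qBlock, D]
  | succ n ih =>
    have hp : pBlock c (n + 1) s = pBlock c n s ++ [Endpoint.mk (c n) (decide (n % 2 = 1)) s] := by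
      simp [pBlock, List.range_succ]
    have hq : qBlock c (n + 1) s = qBlock c n s ++ [Endpoint.mk (c n) (decide (n % 2 = 0)) s] := by
      simp [qBlock, List.range_succ]
    have hb : bar (Endpoint.mk (c n) (decide (n % 2 = 1)) s) =
        Endpoint.mk (c n) (decide (n % 2 = 0)) s := by
      simp only [bar, Endpoint.mk.injEq, true_and, and_true]
      rcases Nat.mod_two_eq_zero_or_one n with h | h <;> simp [h]
    have hD : D (pBlock c (n + 1) s) = D (pBlock c n s) ++
        [Endpoint.mk (c n) (decide (n % 2 = 1)) s, Endpoint.mk (c n) (decide (n % 2 = 0)) s] := by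
      rw [hp, ← hb]; simp [D]
    rw [hD, hp, hq]
    rw [← Multiset.coe_eq_coe] at ih ⊢
    simp only [← Multiset.coe_add, ← Multiset.cons_coe, ← Multiset.singleton_add,
      Multiset.coe_nil] at ih ⊢
    rw [← ih]
    abel

theorem nodup_labels_pBlock {c : ℕ → ℕ} {n : ℕ} (s : Bool)
    (hc : ∀ i < n, ∀ j < n, c i = c j → i = j) : (labels (pBlock c n s)).Nodup := by
  rw [labels_pBlock]
  refine List.Nodup.map_on ?_ List.nodup_range
  intro x hx y hy h
  exact hc x (List.mem_range.1 hx) y (List.mem_range.1 hy) h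

theorem gauss_move2k {k : ℕ} {L L' : List Endpoint} (h : move2k k L L') :
    IsGaussDiagram L ↔ IsGaussDiagram L' := by
  obtain ⟨A, B, C, c, s, hc, hd, rfl, rfl⟩ := h
  change IsGaussDiagram (A ++ pBlock c (2 * k) s ++ B ++ qBlock c (2 * k) s ++ C) ↔ _
  refine gauss_add_perm (P := pBlock c (2 * k) s ++ qBlock c (2 * k) s) ?_ ?_ ?_
  · rw [← Multiset.coe_eq_coe]
    simp only [← Multiset.coe_add]
    abel
  · exact gauss_perm (D_pBlock_perm c _ s).symm (gauss_D _ (nodup_labels_pBlock s hc))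
  · intro x hx
    rw [labels_append, labels_pBlock, labels_qBlock, List.mem_append, or_self] at hx
    obtain ⟨i, hi, rfl⟩ := List.mem_map.1 hx
    exact hd i (List.mem_range.1 hi)

theorem alt_block (n : ℕ) (f : ℕ → Endpoint) (i : ℕ) (hi : i < n)
    (hf : ∀ j < n, (f j).label = (f i).label → j = i) :
    alt (f i).label ((List.range n).map f) = (-1) ^ i := by
  induction n with
  | zero => omega
  | succ n ih =>
    rw [List.range_succ, List.map_append, alt_append]
    by_cases hin : i = n
    · subst hin
      rw [alt_notMem]
      · simp [alt]
      · intro hm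
        simp only [labels, List.map_map, List.mem_map, List.mem_range, Function.comp] at hm
        obtain ⟨j, hj, he⟩ := hm
        have := hf j (by omega) he
        omega
    · rw [ih (by omega) (fun j hj => hf j (by omega))]
      have : (f n).label ≠ (f i).label := fun h => hin (hf n (by omega) h).symm
      simp [alt, this]

theorem wsum_const (w : ℕ → ℤ) (v : ℤ) (s : Bool) (L : List Endpoint)
    (h : ∀ e ∈ L, e.sign = s ∧ w e.label = v) :
    wsum w L = L.length * ((if s then 1 else -1) * v) := by
  induction L with
  | nil => simp [wsum_nil]
  | cons x L ih =>
    rw [wsum_cons, ih (fun e he => h e (List.mem_cons_of_mem _ he))]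
    obtain ⟨h1, h2⟩ := h x (by simp)
    simp only [signValue, h1, h2, List.length_cons]
    push_cast
    ring

theorem inv_move2k_aux {k : ℕ} (A B C : List Endpoint) (c : ℕ → ℕ) (s : Bool)
    (hc : ∀ i < 2 * k, ∀ j < 2 * k, c i = c j → i = j)
    (hd : ∀ i < 2 * k, c i ∉ labels (A ++ B ++ C)) :
    inv (A ++ pBlock c (2 * k) s ++ B ++ qBlock c (2 * k) s ++ C) =
      4 * k * ((if s then 1 else -1) * (1 + (-1) ^ B.length) ^ 2) + inv (A ++ B ++ C) := by
  have lp : (pBlock c (2 * k) s).length = 2 * k := by simp [pBlock]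
  have lq : (qBlock c (2 * k) s).length = 2 * k := by simp [qBlock]
  rw [inv_remove (P := pBlock c (2 * k) s ++ qBlock c (2 * k) s) (L' := A ++ B ++ C)]
  · congr 1
    rw [wsum_const _ ((1 + (-1) ^ B.length) ^ 2) s]
    · rw [List.length_append, lp, lq]; push_cast; ring
    · intro e he
      have : ∃ i < 2 * k, e.label = c i ∧ e.sign = s := by
        rcases List.mem_append.1 he with he | he
        · obtain ⟨i, hi, rfl⟩ := List.mem_map.1 he
          exact ⟨i, List.mem_range.1 hi, rfl, rfl⟩
        · obtain ⟨i, hi, rfl⟩ := List.mem_map.1 he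
          exact ⟨i, List.mem_range.1 hi, rfl, rfl⟩
      obtain ⟨i, hi, h1, h2⟩ := this
      refine ⟨h2, ?_⟩
      have hdi := hd i hi
      simp only [labels_append, List.mem_append, not_or] at hdi
      have ap : alt (c i) (pBlock c (2 * k) s) = (-1) ^ i :=
        alt_block (2 * k) (fun i => Endpoint.mk (c i) (decide (i % 2 = 1)) s) i hi
          (fun j hj h => hc j hj i hi h)
      have aq : alt (c i) (qBlock c (2 * k) s) = (-1) ^ i :=
        alt_block (2 * k) (fun i => Endpoint.mk (c i) (decide (i % 2 = 0)) s) i hi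
          (fun j hj h => hc j hj i hi h)
      simp only [h1, alt_append, ap, aq, alt_notMem _ _ hdi.1.1, alt_notMem _ _ hdi.1.2,
        alt_notMem _ _ hdi.2, List.length_append, lp, pow_add, pow_mul]
      have e1 : ((-1 : ℤ) ^ A.length) ^ 2 = 1 := by rw [← pow_mul, mul_comm, pow_mul]; simp
      have e2 : ((-1 : ℤ) ^ i) ^ 2 = 1 := by rw [← pow_mul, mul_comm, pow_mul]; simp
      have e3 : (((-1 : ℤ) ^ 2) ^ k) = 1 := by simp
      rw [e3]
      linear_combination ((-1 : ℤ) ^ i) ^ 2 * (1 + (-1) ^ B.length) ^ 2 * e1 +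
        (1 + (-1) ^ B.length) ^ 2 * e2
  · rw [← Multiset.coe_eq_coe]
    simp only [← Multiset.coe_add]
    abel
  · intro x hx
    have hpx : x ∉ labels (pBlock c (2 * k) s) := by
      rw [labels_pBlock]
      intro h
      obtain ⟨i, hi, rfl⟩ := List.mem_map.1 h
      exact hd i (List.mem_range.1 hi) hx
    have hqx : x ∉ labels (qBlock c (2 * k) s) := by
      rw [labels_qBlock, ← labels_pBlock c (2 * k) s]; exact hpx
    simp only [alt_append, alt_notMem _ _ hpx, alt_notMem _ _ hqx, List.length_append, lp, lq,
      pow_add, pow_mul]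
    simp

theorem inv_move2k {k : ℕ} {L L' : List Endpoint} (h : move2k k L L') :
    (16 * k : ℤ) ∣ inv L - inv L' := by
  obtain ⟨A, B, C, c, s, hc, hd, rfl, rfl⟩ := h
  have := inv_move2k_aux A B C c s hc hd
  unfold pBlock qBlock at this
  rw [this, add_sub_cancel_right]
  rcases neg_one_pow_eq_or ℤ B.length with h | h
  · rw [h]; exact ⟨if s then 1 else -1, by ring⟩
  · rw [h]; simp

theorem rel2kXi_inv {k : ℕ} {L L' : List Endpoint} (h : Rel2kXi k L L') (H : IsGaussDiagram L) :
    IsGaussDiagram L' ∧ (16 * k : ℤ) ∣ inv L - inv L' := by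
  unfold Rel2kXi Moves at h
  have key : ∀ M M', (reidStep M M' ∨ move2k k M M' ∨ xiStep M M') →
      (IsGaussDiagram M ↔ IsGaussDiagram M') ∧
        (IsGaussDiagram M → (16 * k : ℤ) ∣ inv M - inv M') := by
    intro M M' h
    rcases h with h | h | h
    · exact ⟨gauss_reidStep h, fun H => by rw [inv_reidStep h H]; simp⟩
    · exact ⟨gauss_move2k h, fun _ => inv_move2k h⟩
    · exact ⟨gauss_perm_iff (xi_perm h), fun _ => by rw [inv_xi h]; simp⟩
  induction h with
  | refl => exact ⟨H, by simp⟩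
  | @tail M M' _ h ih =>
    obtain ⟨h1, h2⟩ := ih
    rcases h with h | h
    · obtain ⟨k1, k2⟩ := key _ _ h
      refine ⟨k1.1 h1, ?_⟩
      have := dvd_add h2 (k2 h1)
      rwa [sub_add_sub_cancel] at this
    · obtain ⟨k1, k2⟩ := key _ _ h
      have h3 := k1.2 h1
      refine ⟨h3, ?_⟩
      have := dvd_sub h2 (k2 h3)
      rwa [show inv L - inv M - (inv M' - inv M) = inv L - inv M' by ring] at this

theorem relXi_rel2kXi (k : ℕ) {L L' : List Endpoint} (h : RelXi L L') : Rel2kXi k L L' := by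
  unfold RelXi Moves at h
  induction h with
  | refl => exact Relation.ReflTransGen.refl
  | tail _ h ih =>
  refine Relation.ReflTransGen.tail ih ?_
  rcases h with (h | h) | (h | h)
  · exact Or.inl (Or.inl h)
  · exact Or.inl (Or.inr (Or.inr h))
  · exact Or.inr (Or.inl h)
  · exact Or.inr (Or.inr (Or.inr h))

theorem relXi_inv {L L' : List Endpoint} (h : RelXi L L') (H : IsGaussDiagram L) :
    IsGaussDiagram L' ∧ inv L = inv L' := by
  have h2 := relXi_rel2kXi 0 h
  have := rel2kXi_inv h2 H
  refine ⟨this.1, ?_⟩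
  have h3 := this.2
  simp only [Nat.cast_zero, mul_zero, zero_dvd_iff] at h3
  linarith

/-! ### The words `G(a)` -/

def Gn (n : ℕ) (s : Bool) : List Endpoint :=
  ((List.range n).map (fun j => shellPair (2 * j) (2 * j + 1) false false s)).flatten

theorem Gn_succ (n : ℕ) (s : Bool) :
    Gn (n + 1) s = Gn n s ++ shellPair (2 * n) (2 * n + 1) false false s := by
  simp [Gn, List.range_succ]

theorem Gn_labels (n : ℕ) (s : Bool) : ∀ c ∈ labels (Gn n s), c < 2 * n := by
  induction n with
  | zero => simp [Gn, labels]
  | succ n ih =>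
    intro c hc
    rw [Gn_succ, labels_append, List.mem_append] at hc
    rcases hc with hc | hc
    · have := ih c hc; omega
    · simp [labels, shellPair] at hc; omega

theorem Gn_length (n : ℕ) (s : Bool) : (Gn n s).length = 4 * n := by
  induction n with
  | zero => simp [Gn]
  | succ n ih => rw [Gn_succ, List.length_append, ih]; simp [shellPair]; omega

theorem gauss_Gn (n : ℕ) (s : Bool) : IsGaussDiagram (Gn n s) := by
  induction n with
  | zero => exact gauss_nil
  | succ n ih =>
    rw [Gn_succ]
    refine (gauss_add_perm (P := D [⟨2 * n, false, s⟩, ⟨2 * n + 1, false, s⟩])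
      (L' := Gn n s) ?_ (gauss_D _ (by simp [labels])) ?_).2 ih
    · refine List.perm_append_comm.trans (List.Perm.append_right _ ?_)
      rw [← Multiset.coe_eq_coe]
      simp only [D_cons, D_nil, shellPair, ← Multiset.cons_coe, bar,
        ← Multiset.singleton_add, Multiset.coe_nil]
      abel
    · intro c hc hm
      rw [mem_labels_D] at hc
      have := Gn_labels n s c hm
      simp [labels] at hc
      omega

theorem inv_Gn (n : ℕ) (s : Bool) : inv (Gn n s) = 16 * n * (if s then 1 else -1) := by
  induction n with
  | zero => simp [Gn, inv, wsum]
  | succ n ih =>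
    rw [Gn_succ, inv_remove (P := shellPair (2 * n) (2 * n + 1) false false s) (L' := Gn n s)
      List.perm_append_comm, ih]
    · rw [wsum_const _ 4 s]
      · cases s <;> simp [shellPair] <;> ring
      · have h1 : 2 * n ∉ labels (Gn n s) := fun h => by have := Gn_labels n s _ h; omega
        have h2 : 2 * n + 1 ∉ labels (Gn n s) := fun h => by have := Gn_labels n s _ h; omega
        have e1 : (-1 : ℤ) ^ (Gn n s).length = 1 := by
          rw [Gn_length, show 4 * n = 2 * (2 * n) by ring, pow_mul]; simp
        intro e he
        simp only [shellPair, List.mem_cons, List.not_mem_nil, or_false] at he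
        rcases he with rfl | rfl | rfl | rfl <;>
          simp [alt_append, alt_notMem _ _ h1, alt_notMem _ _ h2, e1, alt, shellPair]
    · intro c hc
      have := Gn_labels n s c hc
      have h1 : 2 * n ≠ c := by omega
      have h2 : 2 * n + 1 ≠ c := by omega
      simp [alt_append, shellPair, alt, h1, h2]

theorem Gword_eq (a : ℤ) : Gword a = Gn a.natAbs (decide (0 < a)) := rfl

theorem gauss_Gword (a : ℤ) : IsGaussDiagram (Gword a) := gauss_Gn _ _

theorem inv_Gword (a : ℤ) : inv (Gword a) = 16 * a := by
  rw [Gword_eq, inv_Gn]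
  by_cases h : 0 < a
  · simp [h, abs_of_pos h]
  · simp [h, abs_of_nonpos (not_lt.1 h)]

end Gauss
namespace Gauss

/-! ### Basic facts on `RelXi` -/

theorem relXi_refl (L : List Endpoint) : RelXi L L := Relation.ReflTransGen.refl

theorem relXi_trans {L M N : List Endpoint} (h : RelXi L M) (h' : RelXi M N) : RelXi L N :=
  Relation.ReflTransGen.trans h h'

theorem moves_symm {r : List Endpoint → List Endpoint → Prop} {L M : List Endpoint}
    (h : Moves r L M) : Moves r M L := by
  unfold Moves at h ⊢
  induction h with
  | refl => exact Relation.ReflTransGen.refl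
  | tail _ h ih => exact Relation.ReflTransGen.head h.symm ih

theorem relXi_symm {L M : List Endpoint} (h : RelXi L M) : RelXi M L := moves_symm h

theorem relXi_reid {L M : List Endpoint} (h : reidStep L M) : RelXi L M :=
  Relation.ReflTransGen.single (Or.inl (Or.inl h))

theorem relXi_xi {L M : List Endpoint} (h : xiStep L M) : RelXi L M :=
  Relation.ReflTransGen.single (Or.inl (Or.inr h))

theorem relXi_rotate (x : Endpoint) (xs : List Endpoint) : RelXi (x :: xs) (xs ++ [x]) :=
  relXi_reid (Or.inl ⟨x, xs, rfl, rfl⟩)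

/-! ### Removing the chords of even parity -/

theorem drop_adjacent {A B : List Endpoint} {x y : Endpoint}
    (H : IsGaussDiagram (A ++ x :: y :: B)) (hl : x.label = y.label) :
    RelXi (A ++ x :: y :: B) (A ++ B) ∧ IsGaussDiagram (A ++ B) := by
  have hp : (A ++ x :: y :: B).Perm (x :: y :: (A ++ B)) :=
    List.perm_append_comm_assoc A [x, y] B
  obtain ⟨rfl, h2, h3⟩ := gauss_two (gauss_perm hp H) hl
  refine ⟨relXi_reid (Or.inr (Or.inr (Or.inl ⟨A, B, x.label, x.isTerminal, x.sign, h2, ?_, rfl⟩))),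
    h3⟩
  simp [bar]

theorem reduce_even (n : ℕ) : ∀ (A M C : List Endpoint) (x x' : Endpoint), M.length = 2 * n →
    IsGaussDiagram (A ++ x :: (M ++ x' :: C)) → x.label = x'.label →
    ∃ G', IsGaussDiagram G' ∧ G'.length < (A ++ x :: (M ++ x' :: C)).length ∧
      RelXi (A ++ x :: (M ++ x' :: C)) G' := by
  induction n with
  | zero =>
    intro A M C x x' hM H hl
    obtain rfl : M = [] := List.length_eq_zero_iff.1 (by simpa using hM)
    obtain ⟨h1, h2⟩ := drop_adjacent H hl
    exact ⟨_, h2, by simp, h1⟩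
  | succ n ih =>
    intro A M C x x' hM H hl
    match M, hM, H with
    | m1 :: m2 :: M, hM, H =>
      by_cases h12 : m1.label = m2.label
      · have e : A ++ x :: (m1 :: m2 :: M ++ x' :: C) =
          (A ++ [x]) ++ m1 :: m2 :: (M ++ x' :: C) := by simp
        rw [e] at H ⊢
        obtain ⟨h1, h2⟩ := drop_adjacent H h12
        exact ⟨_, h2, by simp, h1⟩
      · have hne : ∀ m ∈ m1 :: m2 :: M, x.label ≠ m.label := by
          intro m hm hxm
          have hp : (A ++ x :: (m1 :: m2 :: M ++ x' :: C)).Perm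
              (x :: x' :: (A ++ (m1 :: m2 :: M) ++ C)) := by
            rw [← Multiset.coe_eq_coe]
            simp only [← Multiset.coe_add, ← Multiset.cons_coe, ← Multiset.singleton_add,
              Multiset.coe_nil]
            abel
          have := (gauss_two (gauss_perm hp H) hl).2.1
          apply this
          rw [hxm]
          exact List.mem_map_of_mem (by simp only [List.mem_append]; tauto)
        have hx : xiStep (A ++ x :: (m1 :: m2 :: M ++ x' :: C))
            ((A ++ [m2, m1]) ++ x :: (M ++ x' :: C)) :=
          ⟨A, M ++ x' :: C, x, m1, m2, hne m1 (by simp), h12, hne m2 (by simp), by simp, by simp⟩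
        obtain ⟨G', g1, g2, g3⟩ := ih (A ++ [m2, m1]) M C x x' (by simp at hM; omega)
          (gauss_perm (xi_perm hx) H) hl
        exact ⟨G', g1, by rw [(xi_perm hx).length_eq]; exact g2, relXi_trans (relXi_xi hx) g3⟩

def weave : List Endpoint → List Endpoint → List Endpoint
  | [], _ => []
  | x :: E, O => x :: weave O E
termination_by E O => E.length + O.length
decreasing_by simp; omega

theorem weave_nil (O : List Endpoint) : weave [] O = [] := by rw [weave]
theorem weave_cons (x : Endpoint) (E O : List Endpoint) :
    weave (x :: E) O = x :: weave O E := by rw [weave]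

theorem exists_weave (n : ℕ) : ∀ G : List Endpoint, G.length = 2 * n →
    ∃ E O, E.length = n ∧ O.length = n ∧ G = weave E O := by
  induction n with
  | zero => intro G hG; exact ⟨[], [], rfl, rfl, by
      rw [weave_nil]; exact List.length_eq_zero_iff.1 (by simpa using hG)⟩
  | succ n ih =>
    intro G hG
    match G, hG with
    | x :: y :: G, hG =>
      obtain ⟨E, O, h1, h2, rfl⟩ := ih G (by simp at hG; omega)
      exact ⟨x :: E, y :: O, by simp [h1], by simp [h2], by rw [weave_cons, weave_cons]⟩

theorem weave_perm (n : ℕ) : ∀ E O : List Endpoint, E.length = n → O.length = n →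
    (weave E O).Perm (E ++ O) := by
  induction n with
  | zero =>
    intro E O h1 h2
    obtain rfl := List.length_eq_zero_iff.1 h1
    obtain rfl := List.length_eq_zero_iff.1 h2
    simp [weave_nil]
  | succ n ih =>
    intro E O h1 h2
    match E, O, h1, h2 with
    | x :: E, y :: O, h1, h2 =>
      rw [weave_cons, weave_cons, List.cons_append]
      refine List.Perm.cons _ (((ih E O (by simpa using h1) (by simpa using h2)).cons y).trans ?_)
      exact List.perm_middle.symm

theorem weave_mem_left (n : ℕ) : ∀ E O : List Endpoint, E.length = n → O.length = n →
    ∀ e ∈ E, ∃ M C, Even M.length ∧ weave E O = M ++ e :: C := by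
  induction n with
  | zero =>
    intro E O h1 h2
    obtain rfl := List.length_eq_zero_iff.1 h1
    simp
  | succ n ih =>
    intro E O h1 h2 e he
    match E, O, h1, h2 with
    | x :: E, y :: O, h1, h2 =>
      rw [weave_cons, weave_cons]
      rcases List.mem_cons.1 he with rfl | he
      · exact ⟨[], _, by simp, rfl⟩
      · obtain ⟨M, C, h3, h4⟩ := ih E O (by simpa using h1) (by simpa using h2) e he
        exact ⟨x :: y :: M, C, by simp only [List.length_cons]; grind, by rw [h4]; rfl⟩

theorem weave_mem_right (n : ℕ) : ∀ E O : List Endpoint, E.length = n → O.length = n →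
    ∀ e ∈ O, ∃ M C, Odd M.length ∧ weave E O = M ++ e :: C := by
  induction n with
  | zero =>
    intro E O h1 h2
    obtain rfl := List.length_eq_zero_iff.1 h2
    simp
  | succ n ih =>
    intro E O h1 h2 e he
    match E, O, h1, h2 with
    | x :: E, y :: O, h1, h2 =>
      rw [weave_cons, weave_cons]
      rcases List.mem_cons.1 he with rfl | he
      · exact ⟨[x], _, by simp, rfl⟩
      · obtain ⟨M, C, h3, h4⟩ := ih E O (by simpa using h1) (by simpa using h2) e he
        exact ⟨x :: y :: M, C, by simp only [List.length_cons]; grind, by rw [h4]; rfl⟩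

theorem weave_mem_both (n : ℕ) : ∀ E O : List Endpoint, E.length = n → O.length = n →
    ∀ e ∈ E, ∀ o ∈ O, ∃ A M C, Even M.length ∧
      (weave E O = A ++ e :: (M ++ o :: C) ∨ weave E O = A ++ o :: (M ++ e :: C)) := by
  induction n with
  | zero =>
    intro E O h1 h2
    obtain rfl := List.length_eq_zero_iff.1 h1
    simp
  | succ n ih =>
    intro E O h1 h2 e he o ho
    match E, O, h1, h2 with
    | x :: E, y :: O, h1, h2 =>
      rw [weave_cons, weave_cons]
      simp only [List.length_cons, Nat.add_right_cancel_iff] at h1 h2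
      rcases List.mem_cons.1 he with rfl | he <;> rcases List.mem_cons.1 ho with rfl | ho
      · exact ⟨[], [], _, by simp, Or.inl rfl⟩
      · obtain ⟨M, C, h3, h4⟩ := weave_mem_right n E O h1 h2 o ho
        exact ⟨[], y :: M, C, by simp only [List.length_cons]; grind, Or.inl (by rw [h4]; rfl)⟩
      · obtain ⟨M, C, h3, h4⟩ := weave_mem_left n E O h1 h2 e he
        exact ⟨[x], M, C, h3, Or.inr (by rw [h4]; rfl)⟩
      · obtain ⟨A, M, C, h3, h4⟩ := ih E O h1 h2 e he o ho
        refine ⟨x :: y :: A, M, C, h3, ?_⟩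
        rcases h4 with h4 | h4
        · left; rw [h4]; rfl
        · right; rw [h4]; rfl

theorem exists_odd_form (m : ℕ) : ∀ G : List Endpoint, G.length = m → IsGaussDiagram G →
    ∃ E O n, E.length = n ∧ O.length = n ∧ (∀ e ∈ E, ∀ o ∈ O, e.label ≠ o.label) ∧
      IsGaussDiagram (E ++ O) ∧ RelXi G (weave E O) := by
  induction m using Nat.strong_induction_on with
  | _ m ih =>
    intro G hm H
    obtain ⟨n, hn⟩ := gauss_even _ _ rfl H
    obtain ⟨E, O, h1, h2, h3⟩ := exists_weave n G (by omega)
    by_cases hd : ∀ e ∈ E, ∀ o ∈ O, e.label ≠ o.label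
    · refine ⟨E, O, n, h1, h2, hd, ?_, ?_⟩
      · rw [h3] at H
        exact gauss_perm (weave_perm n E O h1 h2) H
      · rw [h3]; exact relXi_refl _
    · push Not at hd
      obtain ⟨e, he, o, ho, hl⟩ := hd
      obtain ⟨A, M, C, ⟨r, hr⟩, h4⟩ := weave_mem_both n E O h1 h2 e he o ho
      have : ∃ G', IsGaussDiagram G' ∧ G'.length < G.length ∧ RelXi G G' := by
        rcases h4 with h4 | h4
        · rw [h3, h4] at H ⊢
          exact reduce_even r A M C e o (by omega) H hl
        · rw [h3, h4] at H ⊢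
          exact reduce_even r A M C o e (by omega) H hl.symm
      obtain ⟨G', g1, g2, g3⟩ := this
      obtain ⟨E', O', n', k1, k2, k3, k4, k5⟩ := ih G'.length (by omega) G' rfl g1
      exact ⟨E', O', n', k1, k2, k3, k4, relXi_trans g3 k5⟩

theorem gauss_left {E O : List Endpoint} (hd : ∀ e ∈ E, ∀ o ∈ O, e.label ≠ o.label)
    (H : IsGaussDiagram (E ++ O)) : IsGaussDiagram E := by
  rw [gauss_iff] at H ⊢
  intro c
  by_cases hc : c ∈ labels E
  · have : filt c O = [] := by
      apply filt_nil_of_notMem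
      intro h
      obtain ⟨e, he, rfl⟩ := List.mem_map.1 hc
      obtain ⟨o, ho, h⟩ := List.mem_map.1 h
      exact hd e he o ho h.symm
    have h2 := H c
    rwa [filt_append, this, List.append_nil] at h2
  · exact Or.inl (filt_nil_of_notMem c E hc)

/-! ### Swaps of adjacent endpoints within one parity class -/

def SwStep (E E' : List Endpoint) : Prop :=
  ∃ A B x y, x.label ≠ y.label ∧ E = A ++ x :: y :: B ∧ E' = A ++ y :: x :: B

def Sw : List Endpoint → List Endpoint → Prop := Relation.ReflTransGen SwStep

theorem SwStep.perm {E E' : List Endpoint} (h : SwStep E E') : E.Perm E' := by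
  obtain ⟨A, B, x, y, -, rfl, rfl⟩ := h
  exact (List.Perm.swap y x B).append_left A

theorem Sw.perm {E E' : List Endpoint} (h : Sw E E') : E.Perm E' := by
  unfold Sw at h
  induction h with
  | refl => exact List.Perm.refl _
  | tail _ h ih => exact ih.trans h.perm

theorem Sw.refl (E : List Endpoint) : Sw E E := Relation.ReflTransGen.refl

theorem Sw.trans {E F G : List Endpoint} (h : Sw E F) (h' : Sw F G) : Sw E G :=
  Relation.ReflTransGen.trans h h'

theorem Sw.context {E E' : List Endpoint} (h : Sw E E') (A B : List Endpoint) :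
    Sw (A ++ E ++ B) (A ++ E' ++ B) := by
  unfold Sw at h
  induction h with
  | refl => exact Sw.refl _
  | tail _ h ih =>
    refine Relation.ReflTransGen.tail ih ?_
    obtain ⟨A', B', x, y, h1, rfl, rfl⟩ := h
    exact ⟨A ++ A', B' ++ B, x, y, h1, by simp, by simp⟩

theorem Sw.swap (x y : Endpoint) (B : List Endpoint) (h : x.label ≠ y.label) :
    Sw (x :: y :: B) (y :: x :: B) :=
  Relation.ReflTransGen.single ⟨[], B, x, y, h, rfl, rfl⟩

theorem Sw.cons {E E' : List Endpoint} (h : Sw E E') (x : Endpoint) : Sw (x :: E) (x :: E') := by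
  have := h.context [x] []
  simpa using this

theorem Sw.move (x : Endpoint) (A B : List Endpoint) (h : ∀ a ∈ A, a.label ≠ x.label) :
    Sw (A ++ x :: B) (x :: (A ++ B)) := by
  induction A with
  | nil => exact Sw.refl _
  | cons a A ih =>
    refine ((ih fun a ha => h a (List.mem_cons_of_mem _ ha)).cons a).trans ?_
    exact Sw.swap a x _ (h a (by simp))

theorem weave_swStep (A : List Endpoint) : ∀ (B O : List Endpoint) (x y : Endpoint),
    (A ++ x :: y :: B).length ≤ O.length + 1 → x.label ≠ y.label →
    (∀ o ∈ O, x.label ≠ o.label ∧ y.label ≠ o.label) →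
    xiStep (weave (A ++ x :: y :: B) O) (weave (A ++ y :: x :: B) O) := by
  induction A with
  | nil =>
    intro B O x y hl hxy hd
    match O, hl, hd with
    | [], hl, _ => simp at hl
    | o :: O, hl, hd =>
      simp only [List.nil_append, weave_cons]
      have := hd o (by simp)
      exact ⟨[], weave O B, x, o, y, this.1, this.2.symm, hxy, by simp, by simp⟩
  | cons a A ih =>
    intro B O x y hl hxy hd
    match O, hl, hd with
    | [], hl, _ => simp at hl
    | o :: O, hl, hd =>
      simp only [List.cons_append, weave_cons]
      obtain ⟨P, Q, u, v, w, h1, h2, h3, h4, h5⟩ := ih B O x y (by simp at hl ⊢; omega) hxy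
        (fun o' ho' => hd o' (List.mem_cons_of_mem _ ho'))
      exact ⟨a :: o :: P, Q, u, v, w, h1, h2, h3, by rw [h4]; simp, by rw [h5]; simp⟩

theorem xiStep_cons {L L' : List Endpoint} (x : Endpoint) (h : xiStep L L') :
    xiStep (x :: L) (x :: L') := by
  obtain ⟨P, Q, u, v, w, h1, h2, h3, h4, h5⟩ := h
  exact ⟨x :: P, Q, u, v, w, h1, h2, h3, by rw [h4]; simp, by rw [h5]; simp⟩

theorem weave_sw_left {E E' : List Endpoint} (h : Sw E E') (O : List Endpoint)
    (hl : E.length = O.length) (hd : ∀ e ∈ E, ∀ o ∈ O, e.label ≠ o.label) :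
    RelXi (weave E O) (weave E' O) := by
  unfold Sw at h
  induction h with
  | refl => exact relXi_refl _
  | @tail F F' h1 h2 ih =>
    refine relXi_trans ih (relXi_xi ?_)
    have hp : E.Perm F := Sw.perm h1
    obtain ⟨A, B, x, y, hxy, rfl, rfl⟩ := h2
    refine weave_swStep A B O x y (by rw [← hp.length_eq]; omega) hxy ?_
    intro o ho
    exact ⟨hd x (hp.mem_iff.2 (by simp)) o ho, hd y (hp.mem_iff.2 (by simp)) o ho⟩

theorem weave_sw_right {E E' : List Endpoint} (h : Sw E E') (O : List Endpoint)
    (hl : E.length = O.length) (hd : ∀ e ∈ E, ∀ o ∈ O, e.label ≠ o.label) :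
    RelXi (weave O E) (weave O E') := by
  unfold Sw at h
  induction h with
  | refl => exact relXi_refl _
  | @tail F F' h1 h2 ih =>
    refine relXi_trans ih (relXi_xi ?_)
    have hp : E.Perm F := Sw.perm h1
    obtain ⟨A, B, x, y, hxy, rfl, rfl⟩ := h2
    have hlen := hp.length_eq
    match O, hl, hd with
    | [], hl, _ => simp at hl hlen; simp [hl] at hlen
    | o :: O, hl, hd =>
      rw [weave_cons, weave_cons]
      refine xiStep_cons o (weave_swStep A B O x y (by simp at hl ⊢ hlen; omega) hxy ?_)
      intro o ho
      exact ⟨hd x (hp.mem_iff.2 (by simp)) o (List.mem_cons_of_mem _ ho),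
        hd y (hp.mem_iff.2 (by simp)) o (List.mem_cons_of_mem _ ho)⟩

theorem sw_to_D (n : ℕ) : ∀ E : List Endpoint, E.length = n → IsGaussDiagram E →
    ∃ e, Sw E (D e) ∧ (labels e).Nodup := by
  induction n using Nat.strong_induction_on with
  | _ n ih =>
    intro E hE H
    cases E with
    | nil => exact ⟨[], Sw.refl _, by simp [labels]⟩
    | cons x M =>
      obtain ⟨A, C, rfl⟩ := List.append_of_mem (gauss_partner H)
      have hp : (x :: (A ++ bar x :: C)).Perm (x :: bar x :: (A ++ C)) :=
        List.Perm.cons _ List.perm_middle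
      obtain ⟨-, g2, g3⟩ := gauss_two (gauss_perm hp H) rfl
      obtain ⟨e, h1, h2⟩ := ih (A ++ C).length (by simp at hE ⊢; omega) _ rfl g3
      refine ⟨x :: e, ?_, ?_⟩
      · have hm := Sw.move (bar x) A C (by
          intro a ha h
          apply g2
          rw [← bar_label x, ← h]
          exact List.mem_map_of_mem (by simp [ha]))
        refine (hm.cons x).trans ?_
        exact (h1.cons (bar x)).cons x
      · simp only [labels, List.map_cons, List.nodup_cons]
        refine ⟨?_, h2⟩
        intro h
        have h' := (mem_labels_D e x.label).2 h
        apply g2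
        exact ((h1.perm.map Endpoint.label).mem_iff).2 h'

theorem D_perm_sw {e e' : List Endpoint} (h : e.Perm e') (hn : (labels e).Nodup) :
    Sw (D e) (D e') := by
  induction h with
  | nil => exact Sw.refl _
  | cons x h ih =>
    simp only [labels, List.map_cons, List.nodup_cons] at hn
    rw [D_cons, D_cons]
    exact ((ih hn.2).cons _).cons _
  | swap x y l =>
    simp only [labels, List.map_cons, List.nodup_cons, List.mem_cons, not_or] at hn
    simp only [D_cons]
    have h1 : y.label ≠ x.label := hn.1.1
    have a1 := Sw.move x [y, bar y] (bar x :: D l) (by simp [bar_label, h1])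
    have a2 := Sw.move (bar x) [y, bar y] (D l) (by simp [bar_label, h1])
    exact a1.trans (a2.cons x)
  | trans h1 h2 ih1 ih2 =>
    exact (ih1 hn).trans (ih2 (((h1.map Endpoint.label).nodup_iff).1 hn))

end Gauss
namespace Gauss

/-! ### Normal form -/

theorem weave_snoc (E : List Endpoint) : ∀ (O : List Endpoint) (x : Endpoint),
    O.length = E.length + 1 → weave O (E ++ [x]) = weave O E ++ [x] := by
  induction E with
  | nil =>
    intro O x h
    match O, h with
    | [o], _ => simp [weave_cons, weave_nil]
  | cons y E ih =>
    intro O x h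
    match O, h with
    | o :: O, h =>
      simp only [List.cons_append, weave_cons]
      rw [ih O x (by simpa using h)]

theorem D_length (e : List Endpoint) : (D e).length = 2 * e.length := by
  induction e with
  | nil => rfl
  | cons h e ih => rw [D_cons, List.length_cons, List.length_cons, ih, List.length_cons]; ring

def S (e o : List Endpoint) : List Endpoint := weave (D e) (D o)

def Good (e o : List Endpoint) : Prop := e.length = o.length ∧ (labels e ++ labels o).Nodup

theorem Good.symm {e o : List Endpoint} (h : Good e o) : Good o e :=
  ⟨h.1.symm, List.perm_append_comm.nodup_iff.1 h.2⟩

theorem Good.perm {e e' o o' : List Endpoint} (h : Good e o) (he : e.Perm e') (ho : o.Perm o') :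
    Good e' o' := by
  refine ⟨by rw [← he.length_eq, ← ho.length_eq, h.1], ?_⟩
  exact (((he.map _).append (ho.map _)).nodup_iff).1 h.2

theorem Good.disj {e o : List Endpoint} (h : Good e o) :
    ∀ x ∈ D e, ∀ y ∈ D o, x.label ≠ y.label := by
  intro x hx y hy hxy
  have h1 := (mem_labels_D e x.label).1 (List.mem_map_of_mem hx)
  have h2 := (mem_labels_D o y.label).1 (List.mem_map_of_mem hy)
  exact (List.nodup_append.1 h.2).2.2 _ h1 _ h2 hxy

theorem Good.length_D {e o : List Endpoint} (h : Good e o) : (D e).length = (D o).length := by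
  rw [D_length, D_length, h.1]

theorem S_perm {e e' o o' : List Endpoint} (h : Good e o) (he : e.Perm e') (ho : o.Perm o') :
    RelXi (S e o) (S e' o') := by
  have hn := List.nodup_append.1 h.2
  have h2 : Good e' o := h.perm he (List.Perm.refl _)
  exact relXi_trans (weave_sw_left (D_perm_sw he hn.1) (D o) h.length_D h.disj)
    (weave_sw_right (D_perm_sw ho hn.2.1) (D e') h2.length_D.symm h2.symm.disj)

theorem Good.flip {h : Endpoint} {e o : List Endpoint} (H : Good (h :: e) o) :
    Good o (bar h :: e) := by
  refine Good.symm ⟨by rw [← H.1]; simp, ?_⟩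
  have : labels (bar h :: e) = labels (h :: e) := by simp [labels, bar_label]
  rw [this]; exact H.2

theorem S_flip {h : Endpoint} {e o : List Endpoint} (H : Good (h :: e) o) :
    RelXi (S (h :: e) o) (S o (bar h :: e)) := by
  have H2 := H.flip
  have hl := H.length_D
  unfold S at *
  rw [D_cons] at hl ⊢
  rw [weave_cons]
  refine relXi_trans (relXi_rotate _ _) ?_
  rw [← weave_snoc _ _ _ (by simp at hl ⊢; omega), D_cons, bar_bar]
  have hsw : Sw (bar h :: D e ++ [h]) (bar h :: h :: D e) := by
    have := Sw.move h (D e) [] (by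
      intro a ha hh
      have h1 := (mem_labels_D e a.label).1 (List.mem_map_of_mem ha)
      have h2 := (List.nodup_append.1 H.2).1
      simp only [labels, List.map_cons, List.nodup_cons] at h2
      rw [hh] at h1
      exact h2.1 h1)
    rw [List.append_nil] at this
    exact this.cons _
  refine weave_sw_right hsw (D o) (by simp at hl ⊢; omega) ?_
  intro x hx y hy hxy
  have hx' : x ∈ D (h :: e) := by
    rw [D_cons]; simp only [List.cons_append, List.mem_cons, List.mem_append,
      List.not_mem_nil, or_false] at hx ⊢
    tauto
  exact H.disj x hx' y hy hxy

theorem Good.tail {h g : Endpoint} {e o : List Endpoint} (H : Good (h :: e) (g :: o)) :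
    Good e o := by
  refine ⟨by simpa using H.1, ?_⟩
  have := H.2
  simp only [labels, List.map_cons] at this ⊢
  exact List.Nodup.sublist (List.Sublist.append (List.sublist_cons_self _ _)
    (List.sublist_cons_self _ _)) this

theorem S_cons_cons (h g : Endpoint) (e o : List Endpoint) :
    S (h :: e) (g :: o) = h :: g :: bar h :: bar g :: S e o := by
  simp only [S, D_cons, weave_cons]

theorem labels_S {e o : List Endpoint} (H : Good e o) (c : ℕ) :
    c ∈ labels (S e o) ↔ c ∈ labels e ∨ c ∈ labels o := by
  have := ((weave_perm _ (D e) (D o) rfl H.length_D.symm).map Endpoint.label).mem_iff (a := c)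
  change c ∈ labels (S e o) ↔ c ∈ labels (D e ++ D o) at this
  rw [this, labels_append, List.mem_append, mem_labels_D, mem_labels_D]

theorem S_cancel_false {h g : Endpoint} {e o : List Endpoint} (H : Good (h :: e) (g :: o))
    (hs : g.sign = !h.sign) (h1 : h.isTerminal = false) (g1 : g.isTerminal = false) :
    RelXi (S (h :: e) (g :: o)) (S e o) := by
  have hn := H.2
  simp only [labels, List.map_cons, List.cons_append, List.nodup_cons, List.mem_append,
    List.mem_cons, List.nodup_append, not_or] at hn
  have hS := labels_S H.tail
  refine relXi_reid (Or.inr (Or.inr (Or.inr (Or.inl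
    ⟨[], [], S e o, h.label, g.label, h.sign, true, ?_, ?_, ?_, ?_, by simp⟩))))
  · exact hn.1.2.1
  · rw [List.nil_append, List.nil_append, hS, not_or]
    exact ⟨hn.1.1, hn.1.2.2⟩
  · rw [List.nil_append, List.nil_append, hS, not_or]
    refine ⟨fun hh => hn.2.2.2 _ hh _ (Or.inl rfl) rfl, hn.2.2.1.1⟩
  · rw [S_cons_cons]
    rcases h with ⟨a, b, c⟩
    rcases g with ⟨a', b', c'⟩
    simp only at hs h1 g1
    subst hs h1 g1
    simp [bar]

theorem S_flip2 {h g : Endpoint} {e o : List Endpoint} (H : Good (h :: e) (g :: o)) :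
    RelXi (S (h :: e) (g :: o)) (S (bar h :: e) (bar g :: o)) ∧
      Good (bar h :: e) (bar g :: o) :=
  ⟨relXi_trans (S_flip H) (S_flip H.flip), H.flip.flip⟩

theorem S_cancel_same {h g : Endpoint} {e o : List Endpoint} (H : Good (h :: e) (g :: o))
    (hs : g.sign = !h.sign) (h1 : h.isTerminal = g.isTerminal) :
    RelXi (S (h :: e) (g :: o)) (S e o) := by
  cases hh : h.isTerminal with
  | false => exact S_cancel_false H hs hh (h1 ▸ hh)
  | true =>
    obtain ⟨a, b⟩ := S_flip2 H
    exact relXi_trans a (S_cancel_false b hs (by simp [bar, hh]) (by simp [bar, ← h1, hh]))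

theorem S_cancel {h g : Endpoint} {e o : List Endpoint} (H : Good (h :: e) (g :: o))
    (hs : g.sign = !h.sign) :
    ∃ e' o', Good e' o' ∧ e'.length = e.length ∧ RelXi (S (h :: e) (g :: o)) (S e' o') := by
  by_cases h1 : h.isTerminal = g.isTerminal
  · exact ⟨e, o, H.tail, rfl, S_cancel_same H hs h1⟩
  · refine ⟨o, e, H.tail.symm, H.tail.1.symm,
      relXi_trans (S_flip H) (S_cancel_same H.flip (by simp [bar, hs]) ?_)⟩
    simp only [bar]
    cases hh : h.isTerminal <;> cases hg : g.isTerminal <;> simp_all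

def cnt (e : List Endpoint) : ℕ := e.countP (fun h => h.isTerminal)

theorem orient (s : Bool) (N : ℕ) : ∀ e o : List Endpoint, cnt e + cnt o = N → Good e o →
    (∀ h ∈ e, h.sign = s) → (∀ h ∈ o, h.sign = s) →
    ∃ e' o', Good e' o' ∧ (∀ h ∈ e', h.sign = s ∧ h.isTerminal = false) ∧
      (∀ h ∈ o', h.sign = s ∧ h.isTerminal = false) ∧ RelXi (S e o) (S e' o') := by
  induction N using Nat.strong_induction_on with
  | _ N ih =>
    intro e o hN H hse hso
    -- first case: a wrongly oriented chord in the first class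
    have step : ∀ e o : List Endpoint, cnt e + cnt o = N → Good e o →
        (∀ h ∈ e, h.sign = s) → (∀ h ∈ o, h.sign = s) → (∃ h ∈ e, h.isTerminal = true) →
        ∃ e' o', Good e' o' ∧ (∀ h ∈ e', h.sign = s ∧ h.isTerminal = false) ∧
          (∀ h ∈ o', h.sign = s ∧ h.isTerminal = false) ∧ RelXi (S e o) (S e' o') := by
      intro e o hN H hse hso ⟨h, he, ht⟩
      have hp := List.perm_cons_erase he
      have H1 := H.perm hp (List.Perm.refl o)
      have hc : cnt e = cnt (e.erase h) + 1 := by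
        unfold cnt
        rw [hp.countP_eq, List.countP_cons]; simp [ht]
      have hc2 : cnt (bar h :: e.erase h) = cnt (e.erase h) := by
        unfold cnt
        rw [List.countP_cons]; simp [bar, ht]
      obtain ⟨e', o', k1, k2, k3, k4⟩ := ih (cnt o + cnt (bar h :: e.erase h)) (by omega) o
        (bar h :: e.erase h) rfl H1.flip hso (by
          intro x hx
          rcases List.mem_cons.1 hx with rfl | hx
          · exact hse h he
          · exact hse x (List.mem_of_mem_erase hx))
      exact ⟨e', o', k1, k2, k3, relXi_trans (S_perm H hp (List.Perm.refl o))
        (relXi_trans (S_flip H1) k4)⟩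
    by_cases he : ∃ h ∈ e, h.isTerminal = true
    · exact step e o hN H hse hso he
    by_cases ho : ∃ h ∈ o, h.isTerminal = true
    · obtain ⟨h, hho, ht⟩ := ho
      match e, hN, H, hse, he with
      | [], hN, H, hse, he =>
        have := H.1
        simp only [List.length_nil] at this
        rw [List.length_eq_zero_iff.1 this.symm] at hho
        simp at hho
      | g :: e, hN, H, hse, he =>
        have hg : g.isTerminal = false := by
          by_contra hg
          exact he ⟨g, by simp, by simpa using hg⟩
        have hp := List.perm_cons_erase hho
        have H1 := H.perm (List.Perm.refl (g :: e)) hp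
        obtain ⟨r, H2⟩ := S_flip2 H1
        have hc : cnt o = cnt (o.erase h) + 1 := by
          unfold cnt
          rw [hp.countP_eq, List.countP_cons]; simp [ht]
        have hc2 : cnt (bar h :: o.erase h) = cnt (o.erase h) := by
          unfold cnt
          rw [List.countP_cons]; simp [bar, ht]
        have hc3 : cnt (g :: e) = cnt e := by
          unfold cnt
          rw [List.countP_cons]; simp [hg]
        have hc4 : cnt (bar g :: e) = cnt e + 1 := by
          unfold cnt
          rw [List.countP_cons]; simp [bar, hg]
        obtain ⟨e', o', k1, k2, k3, k4⟩ := step (bar g :: e) (bar h :: o.erase h) (by omega) H2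
          (by
            intro x hx
            rcases List.mem_cons.1 hx with rfl | hx
            · exact hse g (by simp)
            · exact hse x (List.mem_cons_of_mem _ hx))
          (by
            intro x hx
            rcases List.mem_cons.1 hx with rfl | hx
            · exact hso h hho
            · exact hso x (List.mem_of_mem_erase hx))
          ⟨bar g, by simp, by simp [bar, hg]⟩
        exact ⟨e', o', k1, k2, k3, relXi_trans (S_perm H (List.Perm.refl _) hp)
          (relXi_trans r k4)⟩
    · push Not at he ho
      exact ⟨e, o, H, fun h hh => ⟨hse h hh, by simpa using he h hh⟩,
        fun h hh => ⟨hso h hh, by simpa using ho h hh⟩, relXi_refl _⟩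

theorem S_eq_map (f : ℕ → ℕ) (s : Bool) (n : ℕ) : ∀ (m : ℕ) (e o : List Endpoint),
    e.length = n → o.length = n →
    (∀ h ∈ e, h.sign = s ∧ h.isTerminal = false) → (∀ h ∈ o, h.sign = s ∧ h.isTerminal = false) →
    (∀ i, (hi : i < e.length) → e[i].label = f (2 * (m + i))) →
    (∀ i, (hi : i < o.length) → o[i].label = f (2 * (m + i) + 1)) →
    S e o = (((List.range' m n).map
      (fun j => shellPair (2 * j) (2 * j + 1) false false s)).flatten).map
        (fun e => Endpoint.mk (f e.label) e.isTerminal e.sign) := by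
  induction n with
  | zero =>
    intro m e o h1 h2 _ _ _ _
    obtain rfl := List.length_eq_zero_iff.1 h1
    simp [S, D_nil, weave_nil]
  | succ n ih =>
    intro m e o h1 h2 he ho fe fo
    match e, o, h1, h2, he, ho, fe, fo with
    | h :: e, g :: o, h1, h2, he, ho, fe, fo =>
      rw [S_cons_cons, ih (m + 1) e o (by simpa using h1) (by simpa using h2)
        (fun x hx => he x (List.mem_cons_of_mem _ hx))
        (fun x hx => ho x (List.mem_cons_of_mem _ hx))
        (fun i hi => by
          have := fe (i + 1) (by simpa using hi)
          simp only [List.getElem_cons_succ] at this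
          rw [this]; congr 1; ring)
        (fun i hi => by
          have := fo (i + 1) (by simpa using hi)
          simp only [List.getElem_cons_succ] at this
          rw [this]; congr 1; ring)]
      have a1 := fe 0 (by simp)
      have a2 := fo 0 (by simp)
      have a3 := he h (by simp)
      have a4 := ho g (by simp)
      rcases h with ⟨l, t, s1⟩
      rcases g with ⟨l', t', s1'⟩
      simp only [List.getElem_cons_zero, Nat.add_zero] at a1 a2 a3 a4
      obtain ⟨rfl, rfl⟩ := a3
      obtain ⟨rfl, rfl⟩ := a4
      subst a1 a2
      rw [List.range'_succ]
      simp [shellPair, bar]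

theorem exists_relabel {e o : List Endpoint} (H : Good e o) : ∃ f : ℕ → ℕ,
    Function.Injective f ∧ (∀ i, (hi : i < e.length) → e[i].label = f (2 * (0 + i))) ∧
    (∀ i, (hi : i < o.length) → o[i].label = f (2 * (0 + i) + 1)) := by
  obtain ⟨hl, hn⟩ := H
  set n := e.length with hnn
  set W := labels e ++ labels o with hW
  have hWl : W.length = 2 * n := by simp [hW, labels, ← hl]; omega
  obtain ⟨M, hM⟩ : ∃ M, ∀ c ∈ W, c < M := by
    refine ⟨W.sum + 1, fun c hc => ?_⟩
    have := List.single_le_sum (l := W) (by simp) c hc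
    omega
  let p : ℕ → ℕ := fun i => if i % 2 = 0 then i / 2 else n + i / 2
  have hp : ∀ i, i < 2 * n → p i < W.length := by
    intro i hi; simp only [p, hWl]; split_ifs <;> omega
  refine ⟨fun i => if h : i < 2 * n then W[p i]'(hp i h) else M + i, ?_, ?_, ?_⟩
  · intro i j hij
    simp only at hij
    split_ifs at hij with h1 h2 h2
    · have := (hn.getElem_inj_iff).1 hij
      simp only [p] at this
      split_ifs at this <;> omega
    · have := hM _ (List.getElem_mem (hp i h1)); omega
    · have := hM _ (List.getElem_mem (hp j h2)); omega
    · omega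
  · intro i hi
    have h1 : 2 * (0 + i) < 2 * n := by omega
    have h2 : p (2 * (0 + i)) = i := by simp [p]
    simp only [h1, dif_pos, h2]
    simp only [hW]
    rw [List.getElem_append_left (by simpa [labels] using hi)]
    simp [labels]
  · intro i hi
    have h1 : 2 * (0 + i) + 1 < 2 * n := by omega
    have h2 : p (2 * (0 + i) + 1) = n + i := by simp only [p]; split_ifs <;> omega
    simp only [h1, dif_pos, h2]
    simp only [hW]
    rw [List.getElem_append_right (by simp [labels, hnn])]
    simp [labels, hnn]

theorem S_to_Gword (n : ℕ) : ∀ e o : List Endpoint, e.length = n → Good e o →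
    ∃ a : ℤ, RelXi (S e o) (Gword a) := by
  induction n using Nat.strong_induction_on with
  | _ n ih =>
    intro e o hn H
    by_cases hc : ∃ h ∈ e, ∃ g ∈ o, g.sign = !h.sign
    · obtain ⟨h, hh, g, hg, hs⟩ := hc
      have p1 := List.perm_cons_erase hh
      have p2 := List.perm_cons_erase hg
      obtain ⟨e', o', k1, k2, k3⟩ := S_cancel (H.perm p1 p2) hs
      have hlt : e'.length < n := by
        have := p1.length_eq
        simp only [List.length_cons] at this
        omega
      obtain ⟨a, ha⟩ := ih _ hlt e' o' rfl k1
      exact ⟨a, relXi_trans (S_perm H p1 p2) (relXi_trans k3 ha)⟩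
    · push Not at hc
      have hs : ∃ s : Bool, (∀ h ∈ e, h.sign = s) ∧ (∀ h ∈ o, h.sign = s) := by
        match e, o, H.1, hc with
        | [], [], _, _ => exact ⟨true, by simp, by simp⟩
        | h :: e, g :: o, _, hc =>
          have key : ∀ x ∈ h :: e, ∀ y ∈ g :: o, y.sign = x.sign := by
            intro x hx y hy
            have := hc x hx y hy
            cases hxs : x.sign <;> cases hys : y.sign <;> simp_all
          refine ⟨g.sign, ?_, ?_⟩
          · intro x hx; exact (key x hx g (by simp)).symm
          · intro y hy
            rw [key h (by simp) y hy, key h (by simp) g (by simp)]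
      obtain ⟨s, hs1, hs2⟩ := hs
      obtain ⟨e', o', k1, k2, k3, k4⟩ := orient s _ e o rfl H hs1 hs2
      obtain ⟨f, hf, f1, f2⟩ := exists_relabel k1
      have hS := S_eq_map f s e'.length 0 e' o' rfl k1.1.symm k2 k3 f1 f2
      have hG : RelXi (S e' o') (Gn e'.length s) := by
        refine relXi_symm (relXi_reid (Or.inr (Or.inl ⟨f, hf, ?_⟩)))
        rw [hS, Gn, List.range_eq_range']
      have hfin : ∃ a : ℤ, Gword a = Gn e'.length s := by
        rcases Nat.eq_zero_or_pos e'.length with h0 | h0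
        · exact ⟨0, by rw [Gword_eq, h0]; simp [Gn]⟩
        · cases s with
          | true => exact ⟨e'.length, by rw [Gword_eq]; simp [h0]⟩
          | false =>
            have hnn : ¬ ((0 : ℤ) < -(e'.length : ℤ)) := by omega
            exact ⟨-e'.length, by
              rw [Gword_eq]
              simp only [hnn, decide_false, Int.natAbs_neg, Int.natAbs_natCast]⟩
      obtain ⟨a, ha⟩ := hfin
      exact ⟨a, by rw [ha]; exact relXi_trans k4 hG⟩

theorem exists_Gword (G : List Endpoint) (H : IsGaussDiagram G) :
    ∃ a : ℤ, RelXi G (Gword a) := by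
  obtain ⟨E, O, n, h1, h2, hd, hg, hr⟩ := exists_odd_form _ G rfl H
  have gE := gauss_left hd hg
  have gO := gauss_left (fun o ho e he => (hd e he o ho).symm)
    (gauss_perm List.perm_append_comm hg)
  obtain ⟨e, se, ne⟩ := sw_to_D _ E rfl gE
  obtain ⟨o, so, no⟩ := sw_to_D _ O rfl gO
  have hmE : ∀ x, x ∈ labels e → x ∈ labels E := fun x hx =>
    ((se.perm.map Endpoint.label).mem_iff).2 ((mem_labels_D e x).2 hx)
  have hmO : ∀ x, x ∈ labels o → x ∈ labels O := fun x hx =>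
    ((so.perm.map Endpoint.label).mem_iff).2 ((mem_labels_D o x).2 hx)
  have hgood : Good e o := by
    refine ⟨?_, List.nodup_append.2 ⟨ne, no, ?_⟩⟩
    · have a1 := se.perm.length_eq
      have a2 := so.perm.length_eq
      rw [D_length] at a1 a2
      omega
    · intro x hx y hy hxy
      obtain ⟨u, hu, rfl⟩ := List.mem_map.1 (hmE x hx)
      obtain ⟨v, hv, rfl⟩ := List.mem_map.1 (hmO y hy)
      exact hd u hu v hv hxy
  obtain ⟨a, ha⟩ := S_to_Gword _ e o rfl hgood
  refine ⟨a, relXi_trans hr (relXi_trans ?_ ha)⟩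
  refine relXi_trans (weave_sw_left se O (by omega) hd) ?_
  refine weave_sw_right so (D e) (by rw [h2, ← se.perm.length_eq, h1]) ?_
  intro u hu v hv
  exact (hd v (se.perm.mem_iff.2 hv) u hu).symm

/-- Classification up to Ξ-moves by the invariant. -/
theorem relXi_Gword {G : List Endpoint} (H : IsGaussDiagram G) {a : ℤ} (h : inv G = 16 * a) :
    RelXi G (Gword a) := by
  obtain ⟨b, hb⟩ := exists_Gword G H
  have := (relXi_inv hb H).2
  rw [inv_Gword] at this
  obtain rfl : a = b := by omega
  exact hb

theorem rel_trans {k : ℕ} {L M N : List Endpoint} (h : Rel2kXi k L M) (h' : Rel2kXi k M N) :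
    Rel2kXi k L N := Relation.ReflTransGen.trans h h'

theorem Gword_shift (k : ℕ) (a : ℤ) : Rel2kXi k (Gword a) (Gword (a + k)) := by
  let c : ℕ → ℕ := fun i => 2 * a.natAbs + i
  have hc : ∀ i < 2 * k, ∀ j < 2 * k, c i = c j → i = j := by
    intro i _ j _ h; simp only [c] at h; omega
  have hd : ∀ i < 2 * k, c i ∉ labels ([] ++ [] ++ Gword a) := by
    intro i _ h
    have := Gn_labels _ _ _ h
    simp only [c] at this; omega
  have hmove : move2k k ([] ++ pBlock c (2 * k) true ++ [] ++ qBlock c (2 * k) true ++ Gword a)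
      ([] ++ [] ++ Gword a) := ⟨[], [], Gword a, c, true, hc, hd, rfl, rfl⟩
  have hinv := inv_move2k_aux [] [] (Gword a) c true hc hd
  have hg := (gauss_move2k hmove).2 (gauss_Gword a)
  have hx := relXi_Gword hg (a := a + k) (by
    rw [hinv]
    simp only [List.nil_append, inv_Gword]
    simp; ring)
  have h1 : Rel2kXi k (Gword a)
      ([] ++ pBlock c (2 * k) true ++ [] ++ qBlock c (2 * k) true ++ Gword a) :=
    Relation.ReflTransGen.single (Or.inr (Or.inr (Or.inl hmove)))
  exact rel_trans h1 (relXi_rel2kXi k hx)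

theorem Gword_shift_nat (k : ℕ) (n : ℕ) (a : ℤ) : Rel2kXi k (Gword a) (Gword (a + k * n)) := by
  induction n with
  | zero => simp only [Nat.cast_zero, mul_zero, add_zero]; exact Relation.ReflTransGen.refl
  | succ n ih =>
    have := Gword_shift k (a + k * n)
    rw [show a + k * n + k = a + k * ((n + 1 : ℕ) : ℤ) by push_cast; ring] at this
    exact rel_trans ih this

theorem Gword_mod (k : ℕ) (a : ℤ) : Rel2kXi k (Gword a) (Gword (a % k)) := by
  have e := Int.emod_add_mul_ediv a k
  rcases Int.eq_nat_or_neg (a / k) with ⟨n, hn | hn⟩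
  · have := Gword_shift_nat k n (a % k)
    rw [← hn, e] at this
    exact moves_symm this
  · have := Gword_shift_nat k n a
    rwa [show a + k * (n : ℤ) = a % k by rw [hn] at e; linarith] at this

theorem exists_unique_rep (k : ℕ) (hk : 0 < k) (G : List Endpoint) (H : IsGaussDiagram G) :
    ∃! a : ℤ, 0 ≤ a ∧ a < k ∧ Rel2kXi k G (Gword a) := by
  have hk' : (0 : ℤ) < k := by exact_mod_cast hk
  obtain ⟨b, hb⟩ := exists_Gword G H
  refine ⟨b % k, ⟨Int.emod_nonneg _ hk'.ne', Int.emod_lt_of_pos _ hk',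
    rel_trans (relXi_rel2kXi k hb) (Gword_mod k b)⟩, ?_⟩
  rintro a ⟨h1, h2, h3⟩
  have d1 := (rel2kXi_inv h3 H).2
  have d2 := (relXi_inv hb H).2
  rw [d2, inv_Gword, inv_Gword, ← mul_sub] at d1
  have d3 : (k : ℤ) ∣ b - a := (mul_dvd_mul_iff_left (by norm_num)).1 d1
  have h := (Int.modEq_iff_dvd).2 d3
  have h5 := Int.emod_eq_of_lt h1 h2
  exact h5.symm.trans h

end Gauss

open Gauss in
/-- `{K(a) : 0 ≤ a < k}` is a complete system of representatives
of virtual knots up to 2k-moves and Ξ-moves: every virtual knot is related to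
exactly one such `K(a)`, and the number of equivalence classes is exactly `k`. -/
theorem rel2kXi_complete_representatives (k : ℕ) (hk : 0 < k) :
    (∀ G : List Endpoint, IsGaussDiagram G →
      ∃! a : ℤ, 0 ≤ a ∧ a < k ∧ Rel2kXi k G (Gword a)) ∧
    Nat.card (Quot (fun (G G' : {L : List Endpoint // IsGaussDiagram L}) =>
      Rel2kXi k G.1 G'.1)) = k := by
  refine ⟨fun G H => exists_unique_rep k hk G H, ?_⟩
  let r := fun (G G' : {L : List Endpoint // IsGaussDiagram L}) => Rel2kXi k G.1 G'.1
  have hr : Equivalence r :=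
    ⟨fun _ => Relation.ReflTransGen.refl, fun h => moves_symm h, fun h h' => rel_trans h h'⟩
  let F : Fin k → Quot r := fun i => Quot.mk r ⟨Gword (i : ℕ), gauss_Gword _⟩
  have hF : Function.Bijective F := by
    constructor
    · intro i j hij
      have h : Rel2kXi k (Gword ((i : ℕ) : ℤ)) (Gword ((j : ℕ) : ℤ)) :=
        (hr.quot_mk_eq_iff _ _).1 hij
      have hu := exists_unique_rep k hk _ (gauss_Gword ((i : ℕ) : ℤ))
      have := hu.unique (y₁ := ((i : ℕ) : ℤ)) (y₂ := ((j : ℕ) : ℤ))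
        ⟨by omega, by have := i.2; omega, Relation.ReflTransGen.refl⟩
        ⟨by omega, by have := j.2; omega, h⟩
      exact Fin.ext (by omega)
    · intro q
      obtain ⟨⟨G, H⟩, rfl⟩ := Quot.exists_rep q
      obtain ⟨a, ⟨h1, h2, h3⟩, -⟩ := exists_unique_rep k hk G H
      refine ⟨⟨a.toNat, by omega⟩, Quot.sound ?_⟩
      change Rel2kXi k (Gword ((a.toNat : ℕ) : ℤ)) G
      rw [Int.toNat_of_nonneg h1]
      exact moves_symm h3
  exact (Nat.card_eq_of_bijective F hF).symm.trans (Nat.card_fin k)
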